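/- Let (Y, d_Y) be a CAT(0) space, let P, Q, R, S be four points of Y, and let λ, μ ∈ [0,1]. Let P_λ and P_{1−λ} be the points on the geodesic from P to S with d_{PP_λ} = λ·d_{PS} and d_{PP_{1−λ}} = (1−λ)·d_{PS}, and let Q_μ and Q_{1−μ} be the points on the geodesic from Q to R with d_{QQ_μ} = μ·d_{QR} and d_{QQ_{1−μ}} = (1−μ)·d_{QR}. Then d_{P_λQ_μ}² + d_{P_{1−λ}Q_{1−μ}}² ≤ d_{PQ}² + d_{RS}² − (λ−μ)·[(1−2λ)·d_{PS}² − (1−2μ)·d_{QR}²] − [(2λ−2λ²) + (μ−λ)(1−2λ)]·(d_{RS} − d_{PQ})². (The key four-point inequality proved in step (iii) of the proof of Lemma 3.2.) -/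

import Mathlib

/-- A geodesic (parametrized on `[0,1]`) in a metric space: the distance between any two
parameter values in `[0,1]` equals `|s - t|` times the distance of the endpoints. -/
def IsGeodesic {Y : Type*} [MetricSpace Y] (γ : ℝ → Y) : Prop :=
  ∀ s ∈ Set.Icc (0:ℝ) 1, ∀ t ∈ Set.Icc (0:ℝ) 1,
    dist (γ s) (γ t) = |s - t| * dist (γ 0) (γ 1)

/-- A CAT(0) space: a geodesic space in which every geodesic satisfies the CAT(0)
comparison inequality. -/
def IsCAT0Space (Y : Type*) [MetricSpace Y] : Prop :=
  (∀ a b : Y, ∃ γ : ℝ → Y, IsGeodesic γ ∧ γ 0 = a ∧ γ 1 = b) ∧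
  (∀ (P : Y) (γ : ℝ → Y), IsGeodesic γ → ∀ t ∈ Set.Icc (0:ℝ) 1,
    dist P (γ t) ^ 2 ≤ (1 - t) * dist P (γ 0) ^ 2 + t * dist P (γ 1) ^ 2
      - t * (1 - t) * dist (γ 0) (γ 1) ^ 2)

/-- The quadrilateral inequality in a CAT(0) space. -/
theorem IsCAT0Space.quadrilateral {Y : Type*} [MetricSpace Y] (hY : IsCAT0Space Y)
    (P Q R S : Y) :
    dist P R ^ 2 + dist Q S ^ 2 ≤
      dist P S ^ 2 + dist Q R ^ 2 + 2 * (dist P Q * dist R S) := by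
  rcases eq_or_ne P Q with rfl | hPQ
  · simp [add_comm]
  rcases eq_or_ne R S with rfl | hRS
  · simp
  have ha := dist_pos.2 hPQ
  have hb := dist_pos.2 hRS
  obtain ⟨γ, hγ, rfl, rfl⟩ := hY.1 Q S
  obtain ⟨t, ht⟩ : ∃ t, t = dist P (γ 0) / (dist P (γ 0) + dist R (γ 1)) := ⟨_, rfl⟩
  have ht0 : 0 < t := ht ▸ by positivity
  have hmul : t * dist R (γ 1) = (1 - t) * dist P (γ 0) := by
    rw [ht]; field_simp; ring
  have ht1 : 0 < 1 - t := pos_of_mul_pos_left (hmul ▸ by positivity) ha.le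
  have hmem : t ∈ Set.Icc (0 : ℝ) 1 := ⟨ht0.le, by linarith⟩
  have hP := mul_le_mul_of_nonneg_left (hY.2 P γ hγ t hmem) ht1.le
  have hR := mul_le_mul_of_nonneg_left (hY.2 R γ hγ t hmem) ht0.le
  have htri : dist P R ≤ dist P (γ t) + dist R (γ t) := dist_triangle_right _ _ _
  have hsq : dist P R ^ 2 ≤ (dist P (γ t) + dist R (γ t)) ^ 2 := by gcongr
  have hsq' := mul_le_mul_of_nonneg_left hsq (mul_pos ht0 ht1).le
  have hconv := sq_nonneg ((1 - t) * dist P (γ t) - t * dist R (γ t))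
  have hprod : (1 - t) ^ 2 * dist P (γ 0) ^ 2 + t ^ 2 * dist R (γ 1) ^ 2 =
      t * (1 - t) * (2 * (dist P (γ 0) * dist R (γ 1))) := by
    linear_combination (t * dist R (γ 1) - (1 - t) * dist P (γ 0)) * hmul
  rw [dist_comm (γ 0) R]
  refine le_of_mul_le_mul_left ?_ (mul_pos ht0 ht1)
  linarith

/-- The CAT(0) inequality applied along both of two geodesics. -/
theorem IsCAT0Space.dist_sq_le {Y : Type*} [MetricSpace Y] (hY : IsCAT0Space Y)
    {γ σ : ℝ → Y} (hγ : IsGeodesic γ) (hσ : IsGeodesic σ) {s t : ℝ}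
    (hs : s ∈ Set.Icc (0 : ℝ) 1) (ht : t ∈ Set.Icc (0 : ℝ) 1) :
    dist (γ s) (σ t) ^ 2 ≤
      (1 - s) * (1 - t) * dist (γ 0) (σ 0) ^ 2 + s * t * dist (γ 1) (σ 1) ^ 2
        + s * (1 - t) * dist (γ 1) (σ 0) ^ 2 + (1 - s) * t * dist (γ 0) (σ 1) ^ 2
        - s * (1 - s) * dist (γ 0) (γ 1) ^ 2 - t * (1 - t) * dist (σ 0) (σ 1) ^ 2 := by
  have h := hY.2 (γ s) σ hσ t ht
  have h0 := mul_le_mul_of_nonneg_left (hY.2 (σ 0) γ hγ s hs) (sub_nonneg.2 ht.2)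
  have h1 := mul_le_mul_of_nonneg_left (hY.2 (σ 1) γ hγ s hs) ht.1
  simp only [dist_comm (σ 0) (γ _), dist_comm (σ 1) (γ _)] at h0 h1
  linarith

/-- Step (iii) of the proof of Lemma 3.2, the key four-point inequality. -/
theorem cat0_four_point_key {Y : Type*} [MetricSpace Y] (hY : IsCAT0Space Y)
    (P Q R S : Y) (l m : ℝ) (hl : l ∈ Set.Icc (0:ℝ) 1) (hm : m ∈ Set.Icc (0:ℝ) 1)
    (γ : ℝ → Y) (hγ : IsGeodesic γ) (hγ0 : γ 0 = P) (hγ1 : γ 1 = S)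
    (σ : ℝ → Y) (hσ : IsGeodesic σ) (hσ0 : σ 0 = Q) (hσ1 : σ 1 = R) :
    dist (γ l) (σ m) ^ 2 + dist (γ (1 - l)) (σ (1 - m)) ^ 2 ≤
      dist P Q ^ 2 + dist R S ^ 2
        - (l - m) * ((1 - 2 * l) * dist P S ^ 2 - (1 - 2 * m) * dist Q R ^ 2)
        - ((2 * l - 2 * l ^ 2) + (m - l) * (1 - 2 * l)) * (dist R S - dist P Q) ^ 2 := by
  subst hγ0 hγ1 hσ0 hσ1
  have h1 := hY.dist_sq_le hγ hσ hl hm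
  have h2 := hY.dist_sq_le hγ hσ (s := 1 - l) (t := 1 - m)
    ⟨by linarith [hl.2], by linarith [hl.1]⟩ ⟨by linarith [hm.2], by linarith [hm.1]⟩
  have hc : 0 ≤ l * (1 - m) + m * (1 - l) :=
    add_nonneg (mul_nonneg hl.1 (sub_nonneg.2 hm.2)) (mul_nonneg hm.1 (sub_nonneg.2 hl.2))
  have h3 := mul_le_mul_of_nonneg_left (hY.quadrilateral (γ 0) (σ 0) (σ 1) (γ 1)) hc
  rw [dist_comm (σ 0) (γ 1)] at h3
  rw [dist_comm (γ 1) (σ 1)] at h1 h2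
  linarith
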